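/- arXiv:1301.6389 — 2 statements merged into one kernel-verified Lean document; each statement's English description precedes it below -/
import Mathlib

section
/- Smooth density criterion via iterated integration by parts: Let (Ω, 𝒜, P) be a probability space and X : Ω → ℝ^d a random vector. Assume that for every n ≥ 1 and every finite sequence of indices i₁, …, i_n ∈ {1, …, d} there exists an integrable random variable Z ∈ L¹(P) such that E[(∂_{i_n} ⋯ ∂_{i₁} f)(X)] = E[f(X) · Z] for every smooth compactly supported function f : ℝ^d → ℝ. Then the law of X is absolutely continuous with respect to Lebesgue measure on ℝ^d and admits a density g which is of class C^∞ on ℝ^d and bounded together with all its partial derivatives. -/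
open MeasureTheory

/-- Iterated partial derivatives along a list of coordinate indices:
`pderivList [i₁, …, iₙ] f = ∂_{iₙ} ⋯ ∂_{i₁} f` (the head of the list acts first,
i.e. innermost). -/
noncomputable def pderivList {d : ℕ} :
    List (Fin d) → (EuclideanSpace ℝ (Fin d) → ℝ) → (EuclideanSpace ℝ (Fin d) → ℝ)
  | [], f => f
  | i :: is, f => pderivList is (fun x => fderiv ℝ f x (EuclideanSpace.single i 1))

namespace SmoothDensity
open Filter Topology Real
open scoped ContDiff FourierTransform

lemma contDiff_pd {d : ℕ} {f : EuclideanSpace ℝ (Fin d) → ℝ} (hf : ContDiff ℝ ∞ f) (i : Fin d) :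
    ContDiff ℝ ∞ (fun x => fderiv ℝ f x (EuclideanSpace.single i 1)) :=
  (hf.fderiv_right (m := ∞) (by simp)).clm_apply contDiff_const

lemma contDiff_pderivList {d : ℕ} (l : List (Fin d)) {f : EuclideanSpace ℝ (Fin d) → ℝ}
    (hf : ContDiff ℝ ∞ f) : ContDiff ℝ ∞ (pderivList l f) := by
  induction l generalizing f with
  | nil => exact hf
  | cons i is ih => exact ih (contDiff_pd hf i)

lemma pderivList_congr {d : ℕ} (l : List (Fin d)) {f g : EuclideanSpace ℝ (Fin d) → ℝ}
    {x : EuclideanSpace ℝ (Fin d)} (h : f =ᶠ[𝓝 x] g) : pderivList l f x = pderivList l g x := by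
  induction l generalizing f g with
  | nil => exact h.self_of_nhds
  | cons i is ih =>
    refine ih ?_
    filter_upwards [h.fderiv (𝕜 := ℝ)] with y hy
    rw [hy]

lemma abs_pderivList_le {d : ℕ} (l : List (Fin d)) {f : EuclideanSpace ℝ (Fin d) → ℝ}
    (hf : ContDiff ℝ ∞ f) (x : EuclideanSpace ℝ (Fin d)) :
    |pderivList l f x| ≤ ‖iteratedFDeriv ℝ l.length f x‖ := by
  induction l generalizing f with
  | nil => simp [pderivList]
  | cons i is ih =>
    refine (ih (contDiff_pd hf i)).trans ?_
    have h := norm_iteratedFDeriv_clm_apply_const (𝕜 := ℝ) (f := fderiv ℝ f)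
      (c := EuclideanSpace.single i (1 : ℝ)) (x := x) (N := ∞) (n := is.length)
      (hf.fderiv_right (m := ∞) (by simp)).contDiffAt (by exact_mod_cast le_top)
    rw [norm_iteratedFDeriv_fderiv] at h
    simpa using h

lemma pd_cos {d : ℕ} (c θ : ℝ) (ξ : EuclideanSpace ℝ (Fin d)) (i : Fin d) :
    (fun x => fderiv ℝ (fun x => c * cos (inner ℝ ξ x + θ)) x (EuclideanSpace.single i 1))
      = fun x => (-(c * ξ i)) * sin (inner ℝ ξ x + θ) := by
  ext x
  have h1 : HasFDerivAt (fun x => inner ℝ ξ x + θ) (innerSL ℝ ξ) x :=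
    ((innerSL ℝ ξ).hasFDerivAt (x := x)).add_const θ
  rw [(h1.cos.const_mul c).fderiv]
  simp [EuclideanSpace.inner_single_right]
  ring

lemma pd_sin {d : ℕ} (c θ : ℝ) (ξ : EuclideanSpace ℝ (Fin d)) (i : Fin d) :
    (fun x => fderiv ℝ (fun x => c * sin (inner ℝ ξ x + θ)) x (EuclideanSpace.single i 1))
      = fun x => (c * ξ i) * cos (inner ℝ ξ x + θ) := by
  ext x
  have h1 : HasFDerivAt (fun x => inner ℝ ξ x + θ) (innerSL ℝ ξ) x :=
    ((innerSL ℝ ξ).hasFDerivAt (x := x)).add_const θ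
  rw [(h1.sin.const_mul c).fderiv]
  simp [EuclideanSpace.inner_single_right]
  ring

lemma pderivList_cos {d : ℕ} (n : ℕ) (c θ : ℝ) (ξ : EuclideanSpace ℝ (Fin d)) (i : Fin d) :
    pderivList (List.replicate (2 * n) i) (fun x => c * cos (inner ℝ ξ x + θ))
      = fun x => (c * (-(ξ i ^ 2)) ^ n) * cos (inner ℝ ξ x + θ) := by
  induction n generalizing c with
  | zero => simp [pderivList]
  | succ n ih =>
    rw [show 2 * (n + 1) = 2 * n + 1 + 1 by ring, List.replicate_succ, List.replicate_succ]
    simp only [pderivList]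
    rw [pd_cos, pd_sin, ih]
    ext x
    ring

lemma bound_cos {d : ℕ} (θ : ℝ) (ξ : EuclideanSpace ℝ (Fin d)) (n : ℕ)
    (x : EuclideanSpace ℝ (Fin d)) :
    ‖iteratedFDeriv ℝ n (fun x => cos (inner ℝ ξ x + θ)) x‖ ≤ ‖ξ‖ ^ n := by
  have h0 : ContDiff ℝ ∞ (fun t : ℝ => cos (t + θ)) :=
    contDiff_cos.comp (contDiff_id.add contDiff_const)
  have h := (innerSL ℝ ξ).iteratedFDeriv_comp_right (i := n) h0 x (by exact_mod_cast le_top)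
  have h2 : (fun x => cos (inner ℝ ξ x + θ)) = (fun t : ℝ => cos (t + θ)) ∘ (innerSL ℝ ξ) := by
    ext; simp
  rw [h2, h]
  refine (ContinuousMultilinearMap.norm_compContinuousLinearMap_le _ _).trans ?_
  rw [iteratedFDeriv_comp_add_right, norm_iteratedFDeriv_eq_norm_iteratedDeriv]
  have := abs_iteratedDeriv_cos_le_one n ((innerSL ℝ ξ) x + θ)
  simp only [Finset.prod_const, Finset.card_univ, Fintype.card_fin, innerSL_apply_norm]
  rw [Real.norm_eq_abs]
  exact mul_le_of_le_one_left (by positivity) this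

/-- a cutoff -/
lemma exists_cutoff (d : ℕ) : ∃ χ : EuclideanSpace ℝ (Fin d) → ℝ, ContDiff ℝ ∞ χ ∧
    HasCompactSupport χ ∧ (∀ x, |χ x| ≤ 1) ∧ (∀ x, ‖x‖ < 1 → χ x = 1) ∧
    ∀ n : ℕ, ∃ C : ℝ, ∀ x, ‖iteratedFDeriv ℝ n χ x‖ ≤ C := by
  let b : ContDiffBump (0 : EuclideanSpace ℝ (Fin d)) := ⟨1, 2, by norm_num, by norm_num⟩
  refine ⟨b, b.contDiff, b.hasCompactSupport, fun x => ?_, fun x hx => ?_, fun n => ?_⟩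
  · rw [abs_of_nonneg b.nonneg]; exact b.le_one
  · exact b.one_of_mem_closedBall (by simpa [b] using hx.le)
  · have h1 : Continuous (iteratedFDeriv ℝ n b) :=
      (b.contDiff (n := ⊤)).continuous_iteratedFDeriv (by exact_mod_cast le_top)
    exact (b.hasCompactSupport.iteratedFDeriv n).exists_bound_of_continuous h1

/-- IBP extends to cosines. -/
lemma ibp_cos {Ω : Type*} [MeasurableSpace Ω] (P : Measure Ω) [IsProbabilityMeasure P]
    {d : ℕ} (X : Ω → EuclideanSpace ℝ (Fin d)) (hX : Measurable X) (l : List (Fin d))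
    (Z : Ω → ℝ) (hZ : Integrable Z P)
    (hI : ∀ f : EuclideanSpace ℝ (Fin d) → ℝ, ContDiff ℝ ∞ f → HasCompactSupport f →
          ∫ w, pderivList l f (X w) ∂P = ∫ w, f (X w) * Z w ∂P)
    (θ : ℝ) (ξ : EuclideanSpace ℝ (Fin d)) :
    ∫ w, pderivList l (fun x => cos (inner ℝ ξ x + θ)) (X w) ∂P
      = ∫ w, cos (inner ℝ ξ (X w) + θ) * Z w ∂P := by
  obtain ⟨χ, hχ, hχc, hχ1, hχ2, hχb⟩ := exists_cutoff d
  choose B hB using hχb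
  set e : EuclideanSpace ℝ (Fin d) → ℝ := fun x => cos (inner ℝ ξ x + θ) with he
  have hes : ContDiff ℝ ∞ e := contDiff_cos.comp ((contDiff_const.inner ℝ contDiff_id).add contDiff_const)
  let a : ℕ → ℝ := fun k => 1 / ((k : ℝ) + 1)
  have ha0 : ∀ k, 0 < a k := fun k => by positivity
  have ha1 : ∀ k, a k ≤ 1 := fun k => by
    simp only [a]; rw [div_le_one (by positivity)]; linarith [Nat.cast_nonneg (α := ℝ) k]
  have hat : Tendsto a atTop (𝓝 0) := tendsto_one_div_add_atTop_nhds_zero_nat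
  let χk : ℕ → EuclideanSpace ℝ (Fin d) → ℝ := fun k x => χ (a k • x)
  have hχk : ∀ k, ContDiff ℝ ∞ (χk k) := fun k => hχ.comp (contDiff_const_smul _)
  let F : ℕ → EuclideanSpace ℝ (Fin d) → ℝ := fun k x => χk k x * e x
  have hF : ∀ k, ContDiff ℝ ∞ (F k) := fun k => (hχk k).mul hes
  have hFc : ∀ k, HasCompactSupport (F k) := fun k =>
    HasCompactSupport.mul_right (hχc.comp_smul (ha0 k).ne')
  have hev : ∀ x, ∀ᶠ k in atTop, F k =ᶠ[𝓝 x] e := by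
    intro x
    have h1 : Tendsto (fun k => ‖a k • x‖) atTop (𝓝 0) := by
      have := (hat.smul_const x).norm
      simpa using this
    filter_upwards [h1.eventually_lt_const one_pos] with k hk
    have : ∀ᶠ y in 𝓝 x, ‖a k • y‖ < 1 :=
      (by fun_prop : Continuous fun y : EuclideanSpace ℝ (Fin d) => ‖a k • y‖).continuousAt.eventually_lt
        continuousAt_const hk
    filter_upwards [this] with y hy
    simp [F, χk, hχ2 _ hy]
  have hχkb : ∀ k n x, ‖iteratedFDeriv ℝ n (χk k) x‖ ≤ B n := by
    intro k n x
    simp only [χk]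
    rw [iteratedFDeriv_comp_const_smul _ (hχ.of_le (by exact_mod_cast le_top))]
    simp only [norm_smul, norm_pow, Real.norm_eq_abs, abs_of_pos (ha0 k)]
    refine (mul_le_of_le_one_left (norm_nonneg _) (pow_le_one₀ (ha0 k).le (ha1 k))).trans (hB n _)
  have hb : ∀ k x, |pderivList l (F k) x| ≤ ∑ i ∈ Finset.range (l.length + 1),
      (l.length.choose i : ℝ) * B i * ‖ξ‖ ^ (l.length - i) := by
    intro k x
    refine (abs_pderivList_le l (hF k) x).trans ?_
    refine (norm_iteratedFDeriv_mul_le (hχk k) hes x (by exact_mod_cast le_top)).trans ?_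
    refine Finset.sum_le_sum fun i _ => ?_
    have hB0 : 0 ≤ B i := (norm_nonneg _).trans (hB i x)
    gcongr
    · exact hχkb _ _ _
    · exact bound_cos _ _ _ _
  have T1 : Tendsto (fun k => ∫ w, pderivList l (F k) (X w) ∂P) atTop
      (𝓝 (∫ w, pderivList l e (X w) ∂P)) := by
    refine tendsto_integral_of_dominated_convergence _ (fun k => ?_) (integrable_const _)
      (fun k => Eventually.of_forall fun w => hb k _) (Eventually.of_forall fun w => ?_)
    · exact ((contDiff_pderivList l (hF k)).continuous.measurable.comp hX).aestronglyMeasurable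
    · refine tendsto_const_nhds.congr' ?_
      filter_upwards [hev (X w)] with k hk
      exact (pderivList_congr l hk).symm
  have T2 : Tendsto (fun k => ∫ w, F k (X w) * Z w ∂P) atTop
      (𝓝 (∫ w, e (X w) * Z w ∂P)) := by
    refine tendsto_integral_of_dominated_convergence (fun w => |Z w|) (fun k => ?_) hZ.abs
      (fun k => Eventually.of_forall fun w => ?_) (Eventually.of_forall fun w => ?_)
    · exact ((hF k).continuous.measurable.comp hX).aestronglyMeasurable.mul hZ.1
    · rw [Real.norm_eq_abs, abs_mul, abs_mul]
      refine mul_le_of_le_one_left (abs_nonneg _) ?_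
      exact mul_le_one₀ (hχ1 _) (abs_nonneg _) (abs_cos_le_one _)
    · refine tendsto_const_nhds.congr' ?_
      filter_upwards [hev (X w)] with k hk
      rw [hk.self_of_nhds]
  refine tendsto_nhds_unique T1 (T2.congr fun k => ?_)
  exact (hI (F k) (hF k) (hFc k)).symm


lemma decay_cos {Ω : Type*} [MeasurableSpace Ω] (P : Measure Ω) [IsProbabilityMeasure P]
    {d : ℕ} (X : Ω → EuclideanSpace ℝ (Fin d)) (hX : Measurable X)
    (hIBP : ∀ l : List (Fin d), l ≠ [] →
      ∃ Z : Ω → ℝ, Integrable Z P ∧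
        ∀ f : EuclideanSpace ℝ (Fin d) → ℝ, ContDiff ℝ ∞ f → HasCompactSupport f →
          ∫ w, pderivList l f (X w) ∂P = ∫ w, f (X w) * Z w ∂P) (n : ℕ) :
    ∃ C : ℝ, ∀ (ξ : EuclideanSpace ℝ (Fin d)) (θ : ℝ),
      ‖ξ‖ ^ n * |∫ w, cos (inner ℝ ξ (X w) + θ) ∂P| ≤ C := by
  have h0 : ∀ (ξ : EuclideanSpace ℝ (Fin d)) (θ : ℝ),
      |∫ w, cos (inner ℝ ξ (X w) + θ) ∂P| ≤ 1 := by
    intro ξ θ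
    have := norm_integral_le_of_norm_le_const (μ := P) (C := 1)
      (f := fun w => cos (inner ℝ ξ (X w) + θ)) (Eventually.of_forall fun w => abs_cos_le_one _)
    simpa using this
  have hi : ∀ i : Fin d, ∃ C : ℝ, ∀ (ξ : EuclideanSpace ℝ (Fin d)) (θ : ℝ),
      (ξ i ^ 2) ^ (n + 1) * |∫ w, cos (inner ℝ ξ (X w) + θ) ∂P| ≤ C := by
    intro i
    obtain ⟨Z, hZ, hI⟩ := hIBP (List.replicate (2 * (n + 1)) i) (by simp)
    refine ⟨∫ w, |Z w| ∂P, fun ξ θ => ?_⟩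
    have h := ibp_cos P X hX _ Z hZ hI θ ξ
    have h2 := pderivList_cos (n + 1) 1 θ ξ i
    simp only [one_mul] at h2
    rw [h2, integral_const_mul] at h
    have h3 : |(-(ξ i ^ 2)) ^ (n + 1)| = (ξ i ^ 2) ^ (n + 1) := by
      rw [abs_pow, abs_neg, abs_of_nonneg (sq_nonneg _)]
    rw [← h3, ← abs_mul, h, ← Real.norm_eq_abs]
    refine norm_integral_le_of_norm_le hZ.abs (Eventually.of_forall fun w => ?_)
    rw [Real.norm_eq_abs, abs_mul]
    exact mul_le_of_le_one_left (abs_nonneg _) (abs_cos_le_one _)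
  choose C hC using hi
  refine ⟨1 + (d : ℝ) ^ n * ∑ i, C i, fun ξ θ => ?_⟩
  set A := |∫ w, cos (inner ℝ ξ (X w) + θ) ∂P| with hA
  have hA0 : 0 ≤ A := abs_nonneg _
  have e1 : (‖ξ‖ ^ 2) ^ (n + 1) ≤ (d : ℝ) ^ n * ∑ i, (ξ i ^ 2) ^ (n + 1) := by
    rw [EuclideanSpace.real_norm_sq_eq]
    simpa using pow_sum_le_card_mul_sum_pow (s := Finset.univ) (f := fun i => ξ i ^ 2)
      (fun i _ => sq_nonneg _) n
  have e2 : (‖ξ‖ ^ 2) ^ (n + 1) * A ≤ (d : ℝ) ^ n * ∑ i, C i := by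
    calc (‖ξ‖ ^ 2) ^ (n + 1) * A ≤ ((d : ℝ) ^ n * ∑ i, (ξ i ^ 2) ^ (n + 1)) * A := by gcongr
      _ = (d : ℝ) ^ n * ∑ i, (ξ i ^ 2) ^ (n + 1) * A := by rw [mul_assoc, Finset.sum_mul]
      _ ≤ _ := by
        gcongr with i
        exact hC i ξ θ
  have e3 : ‖ξ‖ ^ n ≤ 1 + (‖ξ‖ ^ 2) ^ (n + 1) := by
    rcases le_total ‖ξ‖ 1 with h | h
    · have := pow_le_one₀ (n := n) (norm_nonneg ξ) h
      have : 0 ≤ (‖ξ‖ ^ 2) ^ (n + 1) := by positivity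
      linarith
    · rw [← pow_mul]
      have := pow_le_pow_right₀ h (show n ≤ 2 * (n + 1) by omega)
      linarith
  calc ‖ξ‖ ^ n * A ≤ (1 + (‖ξ‖ ^ 2) ^ (n + 1)) * A := by gcongr
    _ = A + (‖ξ‖ ^ 2) ^ (n + 1) * A := by ring
    _ ≤ _ := add_le_add (h0 ξ θ) e2

/-- The (conjugate) characteristic function. -/
noncomputable def psi {d : ℕ} (μ : Measure (EuclideanSpace ℝ (Fin d))) :
    EuclideanSpace ℝ (Fin d) → ℂ :=
  VectorFourier.fourierIntegral 𝐞 μ (-innerₗ (EuclideanSpace ℝ (Fin d))) (fun _ => (1 : ℂ))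

lemma hLcont {d : ℕ} : Continuous fun p : EuclideanSpace ℝ (Fin d) × EuclideanSpace ℝ (Fin d) ↦
    (-innerₗ (EuclideanSpace ℝ (Fin d))) p.1 p.2 := by
  simp only [LinearMap.neg_apply, innerₗ_apply_apply]
  fun_prop

lemma psi_continuous {d : ℕ} (μ : Measure (EuclideanSpace ℝ (Fin d))) [IsProbabilityMeasure μ] :
    Continuous (psi μ) :=
  VectorFourier.fourierIntegral_continuous continuous_fourierChar hLcont (integrable_const _)

lemma psi_eq {d : ℕ} (μ : Measure (EuclideanSpace ℝ (Fin d))) (ξ : EuclideanSpace ℝ (Fin d)) :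
    psi μ ξ = ∫ x, Complex.exp ((inner ℝ ((2 * π) • ξ) x : ℝ) * Complex.I) ∂μ := by
  simp only [psi, VectorFourier.fourierIntegral]
  congr 1 with x
  rw [Circle.smul_def, Real.fourierChar_apply]
  simp only [LinearMap.neg_apply, innerₗ_apply_apply, neg_neg, smul_eq_mul, mul_one,
    real_inner_smul_left]
  rw [real_inner_comm]

lemma psi_decay {Ω : Type*} [MeasurableSpace Ω] (P : Measure Ω) [IsProbabilityMeasure P]
    {d : ℕ} (X : Ω → EuclideanSpace ℝ (Fin d)) (hX : Measurable X)
    (hIBP : ∀ l : List (Fin d), l ≠ [] →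
      ∃ Z : Ω → ℝ, Integrable Z P ∧
        ∀ f : EuclideanSpace ℝ (Fin d) → ℝ, ContDiff ℝ ∞ f → HasCompactSupport f →
          ∫ w, pderivList l f (X w) ∂P = ∫ w, f (X w) * Z w ∂P) (n : ℕ) :
    ∃ C : ℝ, ∀ ξ : EuclideanSpace ℝ (Fin d), ‖ξ‖ ^ n * ‖psi (P.map X) ξ‖ ≤ C := by
  obtain ⟨C, hC⟩ := decay_cos P X hX hIBP n
  refine ⟨C + C, fun ξ => ?_⟩
  set η := (2 * π) • ξ with hη
  have hn : ‖ξ‖ ≤ ‖η‖ := by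
    rw [hη, norm_smul, Real.norm_eq_abs, abs_of_pos (by positivity)]
    have := pi_gt_three
    exact le_mul_of_one_le_left (norm_nonneg _) (by linarith)
  have hm : Measurable fun x : EuclideanSpace ℝ (Fin d) =>
      Complex.exp ((inner ℝ η x : ℝ) * Complex.I) := by
    have : Continuous fun x : EuclideanSpace ℝ (Fin d) =>
      Complex.exp ((inner ℝ η x : ℝ) * Complex.I) := by fun_prop
    exact this.measurable
  have h1 : psi (P.map X) ξ = ∫ w, Complex.exp ((inner ℝ η (X w) : ℝ) * Complex.I) ∂P := by
    rw [psi_eq, integral_map hX.aemeasurable hm.aestronglyMeasurable]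
  have hint : Integrable (fun w => Complex.exp ((inner ℝ η (X w) : ℝ) * Complex.I)) P :=
    Integrable.of_bound (hm.comp hX).aestronglyMeasurable 1
      (Eventually.of_forall fun w => by rw [Complex.norm_exp_ofReal_mul_I])
  have hre : (psi (P.map X) ξ).re = ∫ w, cos (inner ℝ η (X w) + 0) ∂P := by
    rw [h1]
    refine (Complex.reCLM.integral_comp_comm hint).symm.trans ?_
    congr 1 with w
    simp [Complex.exp_ofReal_mul_I_re]
  have him : (psi (P.map X) ξ).im = ∫ w, cos (inner ℝ η (X w) + (-(π / 2))) ∂P := by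
    rw [h1]
    refine (Complex.imCLM.integral_comp_comm hint).symm.trans ?_
    congr 1 with w
    rw [← sub_eq_add_neg, cos_sub_pi_div_two]
    simp [Complex.exp_ofReal_mul_I_im]
  calc ‖ξ‖ ^ n * ‖psi (P.map X) ξ‖
      ≤ ‖η‖ ^ n * (|(psi (P.map X) ξ).re| + |(psi (P.map X) ξ).im|) := by
        gcongr
        exact Complex.norm_le_abs_re_add_abs_im _
    _ = ‖η‖ ^ n * |(psi (P.map X) ξ).re| + ‖η‖ ^ n * |(psi (P.map X) ξ).im| := by ring
    _ ≤ C + C := by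
        rw [hre, him]
        exact add_le_add (hC _ _) (hC _ _)

lemma fourier_bounds {d : ℕ} (ψ : EuclideanSpace ℝ (Fin d) → ℂ) (hψ : Continuous ψ)
    (hint : ∀ n : ℕ, Integrable (fun v ↦ ‖v‖ ^ n * ‖ψ v‖)) (n : ℕ) :
    ∃ C : ℝ, ∀ x, ‖iteratedFDeriv ℝ n (𝓕 ψ) x‖ ≤ C := by
  have h := Real.iteratedFDeriv_fourier (N := ⊤) (fun n _ => hint n) hψ.aestronglyMeasurable
    (n := n) le_top
  refine ⟨∫ v, ‖VectorFourier.fourierPowSMulRight (innerSL ℝ) ψ v n‖, fun x => ?_⟩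
  rw [h]
  exact VectorFourier.norm_fourierIntegral_le_integral_norm _ _ _ _ _

lemma integral_test {d : ℕ} (μ : Measure (EuclideanSpace ℝ (Fin d))) [IsProbabilityMeasure μ]
    (hint : Integrable (psi μ)) (f : EuclideanSpace ℝ (Fin d) → ℝ) (hf : ContDiff ℝ ∞ f)
    (hc : HasCompactSupport f) :
    ∫ x, f x ∂μ = ∫ x, f x * (𝓕 (psi μ) x).re := by
  let F : EuclideanSpace ℝ (Fin d) → ℂ := fun x => (f x : ℂ)
  have hF : ContDiff ℝ ∞ F := Complex.ofRealCLM.contDiff.comp hf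
  have hFc : HasCompactSupport F := hc.comp_left (g := fun r : ℝ => (r : ℂ)) (by simp)
  let S := hFc.toSchwartzMap hF
  have hS : ⇑S = F := rfl
  have hFi : Integrable F := S.integrable
  have hFF : Integrable (𝓕 F) := by
    have := (𝓕 S).integrable (μ := volume)
    rwa [SchwartzMap.fourier_coe] at this
  have hinv : 𝓕⁻ (𝓕 F) = F := hF.continuous.fourierInv_fourier_eq hFi hFF
  have h1 : ∫ ξ, psi μ ξ • 𝓕 F ξ = ∫ x, (1 : ℂ) • 𝓕⁻ (𝓕 F) x ∂μ := by
    have := VectorFourier.integral_fourierIntegral_smul_eq_flip (μ := μ) (ν := volume)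
      (f := fun _ => (1 : ℂ)) (g := 𝓕 F) continuous_fourierChar hLcont (integrable_const _) hFF
    rw [psi, this]
    congr 1 with x
    simp [Real.fourierInv_eq, VectorFourier.fourierIntegral, real_inner_comm]
  have h2 : ∫ ξ, 𝓕 F ξ • psi μ ξ = ∫ x, F x • 𝓕 (psi μ) x := by
    have := VectorFourier.integral_fourierIntegral_smul_eq_flip (μ := volume) (ν := volume)
      (L := innerₗ (EuclideanSpace ℝ (Fin d)))
      (f := F) (g := psi μ) continuous_fourierChar continuous_inner hFi hint
    simpa using! this
  rw [hinv] at h1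
  have h3 : ∫ x, F x ∂μ = ∫ x, F x • 𝓕 (psi μ) x := by
    rw [← h2]
    simp only [one_smul] at h1
    rw [← h1]
    congr 1 with x
    simp [mul_comm]
  have hg : Continuous (𝓕 (psi μ)) :=
    VectorFourier.fourierIntegral_continuous continuous_fourierChar continuous_inner hint
  have hFg : Integrable fun x => F x • 𝓕 (psi μ) x :=
    (hF.continuous.smul hg).integrable_of_hasCompactSupport hFc.smul_right
  have h4 := congrArg Complex.re h3
  rw [show ∫ x, F x ∂μ = ((∫ x, f x ∂μ : ℝ) : ℂ) from integral_ofReal] at h4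
  rw [Complex.ofReal_re] at h4
  rw [h4]
  refine (Complex.reCLM.integral_comp_comm hFg).symm.trans ?_
  congr 1 with x
  simp [F]

lemma measure_eq {d : ℕ} (μ : Measure (EuclideanSpace ℝ (Fin d))) [IsProbabilityMeasure μ]
    (g : EuclideanSpace ℝ (Fin d) → ℝ) (hg : Continuous g)
    (h : ∀ f : EuclideanSpace ℝ (Fin d) → ℝ, ContDiff ℝ ∞ f → HasCompactSupport f →
      ∫ x, f x ∂μ = ∫ x, f x * g x) :
    μ = volume.withDensity (fun x => ENNReal.ofReal (g x)) := by
  let V : Measure (EuclideanSpace ℝ (Fin d)) := volume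
  let ρ := μ + V
  have iV : SigmaFinite V := inferInstanceAs (SigmaFinite volume)
  have iρ : SigmaFinite ρ := inferInstanceAs (SigmaFinite (μ + V))
  have hμ : μ ≪ ρ := Measure.absolutelyContinuous_of_le (Measure.le_add_right le_rfl)
  have hV : V ≪ ρ := Measure.absolutelyContinuous_of_le (Measure.le_add_left le_rfl)
  let p := μ.rnDeriv ρ
  let q := V.rnDeriv ρ
  have hp : ρ.withDensity p = μ := Measure.withDensity_rnDeriv_eq _ _ hμ
  have hq : ρ.withDensity q = V := Measure.withDensity_rnDeriv_eq _ _ hV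
  have hpf : ∀ᵐ x ∂ρ, p x < ⊤ := Measure.rnDeriv_lt_top _ _
  have hqf : ∀ᵐ x ∂ρ, q x < ⊤ := Measure.rnDeriv_lt_top _ _
  have hpm : Measurable p := Measure.measurable_rnDeriv _ _
  have hqm : Measurable q := Measure.measurable_rnDeriv _ _
  have hpl : LocallyIntegrable (fun x => (p x).toReal) ρ :=
    Integrable.locallyIntegrable Measure.integrable_toReal_rnDeriv
  have hql : LocallyIntegrable (fun x => g x * (q x).toReal) ρ := by
    rw [locallyIntegrable_iff]
    intro K hK
    have h1 : IntegrableOn g K V := hg.continuousOn.integrableOn_compact hK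
    have h2 : Integrable (K.indicator g) V := h1.integrable_indicator hK.measurableSet
    rw [← hq, integrable_withDensity_iff hqm hqf] at h2
    rw [← integrable_indicator_iff hK.measurableSet]
    refine h2.congr (Eventually.of_forall fun x => ?_)
    by_cases hx : x ∈ K <;> simp [hx]
  have key : ∀ᵐ x ∂ρ, (p x).toReal = g x * (q x).toReal := by
    refine ae_eq_of_integral_contDiff_smul_eq hpl hql fun f hf hc => ?_
    have h1 := h f hf hc
    change ∫ x, f x ∂μ = ∫ x, f x * g x ∂V at h1
    rw [← hp, ← hq, integral_withDensity_eq_integral_toReal_smul hpm hpf,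
      integral_withDensity_eq_integral_toReal_smul hqm hqf] at h1
    simp only [smul_eq_mul] at h1 ⊢
    rw [show (∫ x, f x * (p x).toReal ∂ρ) = ∫ x, (p x).toReal * f x ∂ρ from
      integral_congr_ae (Eventually.of_forall fun x => by simp [mul_comm]), h1]
    congr 1 with x
    ring
  have e1 : p =ᵐ[ρ] q * fun x => ENNReal.ofReal (g x) := by
    filter_upwards [key, hpf, hqf] with x hx h1 h2
    rw [← ENNReal.ofReal_toReal h1.ne, hx, ENNReal.ofReal_mul' ENNReal.toReal_nonneg,
      ENNReal.ofReal_toReal h2.ne, mul_comm]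
    rfl
  change μ = V.withDensity _
  conv_lhs => rw [← hp]
  conv_rhs => rw [← hq]
  rw [withDensity_congr_ae e1, withDensity_mul _ hqm hg.measurable.ennreal_ofReal]

end SmoothDensity

/-- Smooth density criterion via iterated integration by parts. -/
theorem smooth_density_of_iterated_integration_by_parts
    {Ω : Type*} [MeasurableSpace Ω] (P : Measure Ω) [IsProbabilityMeasure P]
    {d : ℕ} (X : Ω → EuclideanSpace ℝ (Fin d)) (hX : Measurable X)
    (hIBP : ∀ l : List (Fin d), l ≠ [] →
      ∃ Z : Ω → ℝ, Integrable Z P ∧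
        ∀ f : EuclideanSpace ℝ (Fin d) → ℝ, ContDiff ℝ (⊤ : ℕ∞) f → HasCompactSupport f →
          ∫ ω, pderivList l f (X ω) ∂P = ∫ ω, f (X ω) * Z ω ∂P) :
    ∃ g : EuclideanSpace ℝ (Fin d) → ℝ,
      ContDiff ℝ (⊤ : ℕ∞) g ∧
      (∀ n : ℕ, ∃ C : ℝ, ∀ x, ‖iteratedFDeriv ℝ n g x‖ ≤ C) ∧
      Measure.map X P = volume.withDensity (fun x => ENNReal.ofReal (g x)) := by
  haveI : IsProbabilityMeasure (P.map X) := Measure.isProbabilityMeasure_map hX.aemeasurable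
  have hcont := SmoothDensity.psi_continuous (P.map X)
  have hdec := SmoothDensity.psi_decay P X hX hIBP
  have hint : ∀ n : ℕ, Integrable (fun v ↦ ‖v‖ ^ n * ‖SmoothDensity.psi (P.map X) v‖) := by
    intro n
    obtain ⟨C₁, h₁⟩ := hdec 0
    obtain ⟨C₂, h₂⟩ := hdec (n + (volume : Measure (EuclideanSpace ℝ (Fin d))).integrablePower)
    exact integrable_of_le_of_pow_mul_le (C₁ := C₁) (C₂ := C₂) (fun x => by simpa using h₁ x) h₂
      hcont.aestronglyMeasurable
  have hpsi : Integrable (SmoothDensity.psi (P.map X)) := by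
    have := hint 0
    simp only [pow_zero, one_mul] at this
    exact (integrable_norm_iff hcont.aestronglyMeasurable).1 this
  have hsm : ContDiff ℝ (⊤ : ℕ∞) (FourierTransform.fourier (SmoothDensity.psi (P.map X))) :=
    Real.contDiff_fourier (N := ⊤) (fun n _ => hint n)
  have hg : ContDiff ℝ (⊤ : ℕ∞)
      (Complex.reCLM ∘ (FourierTransform.fourier (SmoothDensity.psi (P.map X)))) :=
    Complex.reCLM.contDiff.comp hsm
  refine ⟨_, hg, fun n => ?_, ?_⟩
  · obtain ⟨C, hC⟩ := SmoothDensity.fourier_bounds _ hcont hint n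
    refine ⟨‖Complex.reCLM‖ * C, fun x => ?_⟩
    refine (Complex.reCLM.norm_iteratedFDeriv_comp_left (hsm.contDiffAt)
      (by exact_mod_cast le_top)).trans ?_
    gcongr
    exact hC x
  · exact SmoothDensity.measure_eq _ _ hg.continuous fun f hf hc =>
      SmoothDensity.integral_test _ hpsi f hf hc
end

section
/- De Bruijn-type Tauberian theorem relating Laplace transform asymptotics to small-ball probabilities, in the form used in the paper: Let V be a nonnegative random variable on a probability space (Ω, 𝒜, P), let α ∈ (0, 1), and suppose the limit L = lim_{λ → +∞} λ^{−α} log E[e^{−λV}] exists and belongs to (−∞, 0). Then, with β = α/(1−α) and with r₂ < 0 the unique negative real determined by |α L|^{1/α} = |β r₂|^{1/β}, one has lim_{ε → 0⁺} ε^β · log P(V ≤ ε) = r₂. -/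
open MeasureTheory Filter

namespace DBAux

lemma neg_of_deriv {F : ℝ → ℝ} {c : ℝ} (hF : HasDerivAt F c 0) (h0 : F 0 = 0) (hc : c < 0) :
    ∀ᶠ t in nhdsWithin (0:ℝ) (Set.Ioi 0), F t < 0 := by
  have h := hF.tendsto_slope_zero_right
  have h2 := h.eventually (gt_mem_nhds hc)
  filter_upwards [h2, self_mem_nhdsWithin] with t ht htp
  have htp' : 0 < t := htp
  simp only [zero_add, h0, sub_zero, smul_eq_mul] at ht
  by_contra hcon
  push Not at hcon
  have : 0 ≤ t⁻¹ * F t := by positivity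
  linarith

lemma exists_params (α K s₁ r δ : ℝ) (hα0 : 0 < α) (hα1 : α < 1) (hK : 0 < K) (hs₁ : 0 < s₁)
    (hs : α * K * s₁ ^ (α - 1) = 1) (hr : r = s₁ - K * s₁ ^ α) (hδ : 0 < δ) :
    ∃ s a t η : ℝ, 0 < t ∧ t < s ∧ 0 < η ∧ r - δ < s * a - K * s ^ α - 2 * η ∧
      t * a - K * (s + t) ^ α + η ≤ - K * s ^ α - 2 * η ∧
      - t - K * (s - t) ^ α + η ≤ - K * s ^ α - 2 * η := by
  have hcont : ContinuousAt (fun s : ℝ => s * (α * K * s ^ (α - 1)) - K * s ^ α) s₁ := by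
    have h1 : ContinuousAt (fun s : ℝ => s ^ (α - 1)) s₁ :=
      Real.continuousAt_rpow_const _ _ (Or.inl hs₁.ne')
    have h2 : ContinuousAt (fun s : ℝ => s ^ α) s₁ :=
      Real.continuousAt_rpow_const _ _ (Or.inl hs₁.ne')
    fun_prop
  have hval : r - δ / 2 < s₁ * (α * K * s₁ ^ (α - 1)) - K * s₁ ^ α := by
    rw [hs, hr]; linarith
  have hev := (hcont.eventually (lt_mem_nhds hval)).filter_mono
    (nhdsWithin_le_nhds (s := Set.Ioi s₁))
  obtain ⟨s, hs1, hss⟩ := (hev.and self_mem_nhdsWithin).exists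
  have hss : s₁ < s := hss
  have hsp : 0 < s := hs₁.trans hss
  set x := α * K * s ^ (α - 1) with hx
  have hx1 : x < 1 := by
    rw [← hs, hx]
    have := Real.rpow_lt_rpow_of_neg hs₁ hss (by linarith : α - 1 < 0)
    exact mul_lt_mul_of_pos_left this (by positivity)
  set a := x - δ / (4 * s) with ha
  have hax : a < x := by
    have : 0 < δ / (4 * s) := by positivity
    linarith
  have hsa : s * a = s * x - δ / 4 := by
    rw [ha]; field_simp
  have hd : HasDerivAt (fun y : ℝ => K * y ^ α) x s := by
    have := (Real.hasDerivAt_rpow_const (x := s) (p := α) (Or.inl hsp.ne')).const_mul K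
    have e : K * (α * s ^ (α - 1)) = x := by rw [hx]; ring
    rwa [e] at this
  have hd1 : HasDerivAt (fun t : ℝ => t * a - K * (s + t) ^ α + K * s ^ α) (a - x) 0 := by
    have e : HasDerivAt (fun t : ℝ => K * (s + t) ^ α) x 0 := by
      have hd' : HasDerivAt (fun y : ℝ => K * y ^ α) x (s + 0) := by simpa using hd
      exact HasDerivAt.comp_const_add s 0 hd'
    have := (((hasDerivAt_id (0:ℝ)).mul_const a).sub e).add_const (K * s ^ α)
    simpa using this
  have hd2 : HasDerivAt (fun t : ℝ => - t - K * (s - t) ^ α + K * s ^ α) (-1 + x) 0 := by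
    have e : HasDerivAt (fun t : ℝ => K * (s - t) ^ α) (-x) 0 := by
      have hd' : HasDerivAt (fun y : ℝ => K * y ^ α) x (s - 0) := by simpa using hd
      exact HasDerivAt.comp_const_sub s 0 hd'
    have := (((hasDerivAt_id (0:ℝ)).neg).sub e).add_const (K * s ^ α)
    simpa using this
  have n1 := neg_of_deriv hd1 (by simp) (by linarith)
  have n2 := neg_of_deriv hd2 (by simp) (by linarith)
  have n3 : ∀ᶠ t in nhdsWithin (0:ℝ) (Set.Ioi 0), t < s :=
    (gt_mem_nhds hsp).filter_mono nhdsWithin_le_nhds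
  obtain ⟨t, ⟨⟨h1, h2⟩, h3⟩, h4⟩ := (((n1.and n2).and n3).and self_mem_nhdsWithin).exists
  have h4 : 0 < t := h4
  set F1 := t * a - K * (s + t) ^ α + K * s ^ α with hF1
  set F2 := - t - K * (s - t) ^ α + K * s ^ α with hF2
  refine ⟨s, a, t, min (δ / 16) (min (-F1 / 3) (-F2 / 3)), h4, h3, ?_, ?_, ?_, ?_⟩
  · refine lt_min (by positivity) (lt_min ?_ ?_) <;> linarith
  · have := min_le_left (δ / 16) (min (-F1 / 3) (-F2 / 3))
    rw [hsa]; linarith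
  · have := (min_le_right (δ / 16) (min (-F1 / 3) (-F2 / 3))).trans (min_le_left _ _)
    linarith
  · have := (min_le_right (δ / 16) (min (-F1 / 3) (-F2 / 3))).trans (min_le_right _ _)
    linarith

lemma integrable_exp {Ω : Type*} [MeasurableSpace Ω] (P : Measure Ω) [IsProbabilityMeasure P]
    (V : Ω → ℝ) (hV : Measurable V) (hVnonneg : ∀ ω, 0 ≤ V ω)
    (l : ℝ) (hl : 0 ≤ l) : Integrable (fun ω => Real.exp (-l * V ω)) P := by
  refine Integrable.of_bound (C := 1) (by fun_prop) (ae_of_all _ fun ω => ?_)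
  rw [Real.norm_eq_abs, abs_of_pos (Real.exp_pos _), Real.exp_le_one_iff]
  nlinarith [mul_nonneg hl (hVnonneg ω)]

lemma phi_pos {Ω : Type*} [MeasurableSpace Ω] (P : Measure Ω) [IsProbabilityMeasure P]
    (V : Ω → ℝ) (hV : Measurable V) (hVnonneg : ∀ ω, 0 ≤ V ω)
    (l : ℝ) (hl : 0 ≤ l) : 0 < ∫ ω, Real.exp (-l * V ω) ∂P :=
  integral_exp_pos (integrable_exp P V hV hVnonneg l hl)

lemma upper {Ω : Type*} [MeasurableSpace Ω] (P : Measure Ω) [IsProbabilityMeasure P]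
    (V : Ω → ℝ) (hV : Measurable V) (hVnonneg : ∀ ω, 0 ≤ V ω)
    (l ε : ℝ) (hl : 0 ≤ l) :
    (P {ω | V ω ≤ ε}).toReal ≤ Real.exp (l * ε) * ∫ ω, Real.exp (-l * V ω) ∂P := by
  have hm : MeasurableSet {ω | V ω ≤ ε} := measurableSet_le hV measurable_const
  have : (P {ω | V ω ≤ ε}).toReal = ∫ ω, Set.indicator {ω | V ω ≤ ε} (fun _ => (1:ℝ)) ω ∂P := by
    rw [integral_indicator_const _ hm]; simp [Measure.real]
  rw [this, ← integral_const_mul]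
  refine integral_mono ((integrable_const _).indicator hm)
    ((integrable_exp P V hV hVnonneg l hl).const_mul _) fun ω => ?_
  simp only [Set.indicator, Set.mem_ofPred_eq]
  split_ifs with h
  · rw [← Real.exp_add, Real.one_le_exp_iff]
    nlinarith [mul_nonneg hl (sub_nonneg.2 h)]
  · positivity

lemma lower {Ω : Type*} [MeasurableSpace Ω] (P : Measure Ω) [IsProbabilityMeasure P]
    (V : Ω → ℝ) (hV : Measurable V) (hVnonneg : ∀ ω, 0 ≤ V ω)
    (l θ a ε : ℝ) (hθ : 0 < θ) (hl : θ ≤ l) :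
    ∫ ω, Real.exp (-l * V ω) ∂P ≤ Real.exp (-l * a) * (P {ω | V ω ≤ ε}).toReal
      + Real.exp (θ * a) * ∫ ω, Real.exp (-(l + θ) * V ω) ∂P
      + Real.exp (-θ * ε) * ∫ ω, Real.exp (-(l - θ) * V ω) ∂P := by
  have hm : MeasurableSet {ω | V ω ≤ ε} := measurableSet_le hV measurable_const
  have : (P {ω | V ω ≤ ε}).toReal = ∫ ω, Set.indicator {ω | V ω ≤ ε} (fun _ => (1:ℝ)) ω ∂P := by
    rw [integral_indicator_const _ hm]; simp [Measure.real]
  have i1 : Integrable (fun ω => Real.exp (-l * a) *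
      Set.indicator {ω | V ω ≤ ε} (fun _ => (1:ℝ)) ω) P :=
    ((integrable_const _).indicator hm).const_mul _
  have i2 : Integrable (fun ω => Real.exp (θ * a) * Real.exp (-(l + θ) * V ω)) P :=
    (integrable_exp P V hV hVnonneg (l + θ) (by linarith)).const_mul _
  have i3 : Integrable (fun ω => Real.exp (-θ * ε) * Real.exp (-(l - θ) * V ω)) P :=
    (integrable_exp P V hV hVnonneg (l - θ) (by linarith)).const_mul _
  rw [this, ← integral_const_mul, ← integral_const_mul, ← integral_const_mul,
    ← integral_add i1 i2]
  have i12 := integral_add (i1.add i2) i3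
  simp only [Pi.add_apply] at i12
  rw [← i12]
  refine integral_mono (integrable_exp P V hV hVnonneg l (by linarith)) ((i1.add i2).add i3)
    fun ω => ?_
  simp only [Set.indicator, Set.mem_ofPred_eq]
  have p2 : 0 < Real.exp (θ * a) * Real.exp (-(l + θ) * V ω) := by positivity
  have p3 : 0 < Real.exp (-θ * ε) * Real.exp (-(l - θ) * V ω) := by positivity
  split_ifs with h
  · rcases le_or_gt (V ω) a with h' | h'
    · have : Real.exp (-l * V ω) ≤ Real.exp (θ * a) * Real.exp (-(l + θ) * V ω) := by
        rw [← Real.exp_add, Real.exp_le_exp]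
        nlinarith [mul_nonneg hθ.le (sub_nonneg.2 h')]
      have : 0 < Real.exp (-l * a) * 1 := by positivity
      linarith
    · have : Real.exp (-l * V ω) ≤ Real.exp (-l * a) := by
        rw [Real.exp_le_exp]
        nlinarith [mul_nonneg (hθ.le.trans hl) (sub_nonneg.2 h'.le)]
      linarith
  · have : Real.exp (-l * V ω) ≤ Real.exp (-θ * ε) * Real.exp (-(l - θ) * V ω) := by
      rw [← Real.exp_add, Real.exp_le_exp]
      push Not at h
      nlinarith [mul_nonneg hθ.le (sub_nonneg.2 h.le)]
    linarith

end DBAux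

open DBAux in
/-- De Bruijn-type Tauberian theorem: if `λ^{−α} log E[e^{−λV}] → L ∈ (−∞, 0)` as
`λ → ∞` with `α ∈ (0,1)`, then with `β = α/(1−α)` and
`r₂ = −(1−α) α^{α/(1−α)} |L|^{1/(1−α)}` (the unique negative real with
`|αL|^{1/α} = |β r₂|^{1/β}`), one has `ε^β log P(V ≤ ε) → r₂` as `ε → 0⁺`. -/
theorem deBruijn_tauberian
    {Ω : Type*} [MeasurableSpace Ω] (P : Measure Ω) [IsProbabilityMeasure P]
    (V : Ω → ℝ) (hV : Measurable V) (hVnonneg : ∀ ω, 0 ≤ V ω)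
    (α L : ℝ) (hα : α ∈ Set.Ioo (0 : ℝ) 1) (hL : L < 0)
    (hlim : Tendsto (fun lam : ℝ =>
        lam ^ (-α) * Real.log (∫ ω, Real.exp (-lam * V ω) ∂P)) atTop (nhds L))
    (β r₂ : ℝ) (hβ : β = α / (1 - α))
    (hr₂ : r₂ < 0) (hr₂eq : |α * L| ^ (1/α) = |β * r₂| ^ (1/β)) :
    Tendsto (fun ε : ℝ => ε ^ β * Real.log (P {ω | V ω ≤ ε}).toReal)
      (nhdsWithin 0 (Set.Ioi 0)) (nhds r₂) := by
  obtain ⟨hα0, hα1⟩ := hα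
  have h1α : 0 < 1 - α := by linarith
  have hβ0 : 0 < β := by rw [hβ]; positivity
  obtain ⟨K, rfl⟩ : ∃ K, L = -K := ⟨-L, by ring⟩
  have hK : 0 < K := by linarith
  set s₁ := -(β * r₂) with hs₁def
  have hs₁ : 0 < s₁ := by rw [hs₁def]; nlinarith
  have habs1 : |α * -K| = α * K := by
    rw [mul_neg, abs_neg, abs_of_pos (by positivity)]
  have habs2 : |β * r₂| = s₁ := by rw [abs_of_neg (by linarith)]
  rw [habs1, habs2] at hr₂eq
  have hαK : 0 < α * K := by positivity
  have hαKeq : α * K = s₁ ^ (1 - α) := by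
    have : ((α * K) ^ (1 / α)) ^ α = (s₁ ^ (1 / β)) ^ α := by rw [hr₂eq]
    rw [← Real.rpow_mul hαK.le, ← Real.rpow_mul hs₁.le, one_div_mul_cancel hα0.ne',
      Real.rpow_one] at this
    rw [this]; congr 1; rw [hβ]; field_simp
  have hs : α * K * s₁ ^ (α - 1) = 1 := by
    rw [hαKeq, ← Real.rpow_add hs₁]; simp
  have hr : r₂ = s₁ - K * s₁ ^ α := by
    have e : s₁ ^ α = s₁ * s₁ ^ (α - 1) := by
      rw [Real.rpow_sub_one hs₁.ne']; field_simp
    have e2 : α * (K * s₁ ^ α) = s₁ := by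
      rw [e]; linear_combination s₁ * hs
    have e3 : (1 - α) * s₁ = - (α * r₂) := by rw [hs₁def, hβ]; field_simp
    have : α * r₂ = α * (s₁ - K * s₁ ^ α) := by linear_combination e2 + e3
    exact mul_left_cancel₀ hα0.ne' this
  -- scaled limit
  set γ := 1 / (1 - α) with hγ
  have hγ0 : 0 < γ := by positivity
  have hℓ : Tendsto (fun ε : ℝ => ε ^ (-γ)) (nhdsWithin 0 (Set.Ioi 0)) atTop := by
    have := (tendsto_rpow_atTop hγ0).comp (tendsto_inv_nhdsGT_zero (𝕜 := ℝ))
    refine this.congr' ?_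
    filter_upwards [self_mem_nhdsWithin] with ε hε
    have hε : 0 < ε := hε
    simp [Real.inv_rpow hε.le, Real.rpow_neg hε.le]
  have hT : Tendsto (fun ε : ℝ => ε ^ (-β)) (nhdsWithin 0 (Set.Ioi 0)) atTop := by
    have := (tendsto_rpow_atTop hβ0).comp (tendsto_inv_nhdsGT_zero (𝕜 := ℝ))
    refine this.congr' ?_
    filter_upwards [self_mem_nhdsWithin] with ε hε
    have hε : 0 < ε := hε
    simp [Real.inv_rpow hε.le, Real.rpow_neg hε.le]
  have hscaled : ∀ s : ℝ, 0 < s → Tendsto (fun ε : ℝ => ε ^ β *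
      Real.log (∫ ω, Real.exp (-(s * ε ^ (-γ)) * V ω) ∂P)) (nhdsWithin 0 (Set.Ioi 0))
      (nhds (-K * s ^ α)) := by
    intro s hsp
    have h := (hlim.comp (hℓ.const_mul_atTop hsp)).mul_const (s ^ α)
    refine h.congr' ?_
    filter_upwards [self_mem_nhdsWithin] with ε hε
    have hε : 0 < ε := hε
    have e : (s * ε ^ (-γ)) ^ (-α) * s ^ α = ε ^ β := by
      rw [Real.mul_rpow hsp.le (by positivity), ← Real.rpow_mul hε.le, mul_right_comm,
        ← Real.rpow_add hsp]
      simp only [neg_add_cancel, Real.rpow_zero, one_mul]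
      congr 1; rw [hβ, hγ]; field_simp
    simp only [Function.comp_apply]
    rw [← e]; ring
  have hlo : ∀ s η : ℝ, 0 < s → 0 < η → ∀ᶠ ε in nhdsWithin (0:ℝ) (Set.Ioi 0),
      Real.exp (ε ^ (-β) * (-K * s ^ α - η)) ≤ ∫ ω, Real.exp (-(s * ε ^ (-γ)) * V ω) ∂P := by
    intro s η hsp hη
    filter_upwards [(hscaled s hsp).eventually (lt_mem_nhds (sub_lt_self _ hη)),
      self_mem_nhdsWithin] with ε h hε
    have hε : 0 < ε := hε
    have hφ := phi_pos P V hV hVnonneg (s * ε ^ (-γ)) (by positivity)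
    rw [← Real.le_log_iff_exp_le hφ, Real.rpow_neg hε.le, inv_mul_le_iff₀ (by positivity)]
    exact h.le
  have hup : ∀ s η : ℝ, 0 < s → 0 < η → ∀ᶠ ε in nhdsWithin (0:ℝ) (Set.Ioi 0),
      ∫ ω, Real.exp (-(s * ε ^ (-γ)) * V ω) ∂P ≤ Real.exp (ε ^ (-β) * (-K * s ^ α + η)) := by
    intro s η hsp hη
    filter_upwards [(hscaled s hsp).eventually (gt_mem_nhds (lt_add_of_pos_right _ hη)),
      self_mem_nhdsWithin] with ε h hε
    have hε : 0 < ε := hε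
    have hφ := phi_pos P V hV hVnonneg (s * ε ^ (-γ)) (by positivity)
    rw [← Real.log_le_iff_le_exp hφ, Real.rpow_neg hε.le β, le_inv_mul_iff₀ (by positivity)]
    exact h.le
  have hγβ : ∀ ε : ℝ, 0 < ε → ε ^ (-γ) * ε = ε ^ (-β) := by
    intro ε hε
    nth_rewrite 2 [← Real.rpow_one ε]
    rw [← Real.rpow_add hε]; congr 1; rw [hβ, hγ]; field_simp; ring
  have hlower : ∀ δ : ℝ, 0 < δ → ∀ᶠ ε in nhdsWithin (0:ℝ) (Set.Ioi 0),
      Real.exp (ε ^ (-β) * (r₂ - δ)) < (P {ω | V ω ≤ ε}).toReal := by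
    intro δ hδ
    obtain ⟨s, a, t, η, ht, hts, hη, c1, c2, c3⟩ :=
      exists_params α K s₁ r₂ δ hα0 hα1 hK hs₁ hs hr hδ
    have hsp : 0 < s := ht.trans hts
    have hbig : ∀ᶠ ε in nhdsWithin (0:ℝ) (Set.Ioi 0), Real.log 4 / η ≤ ε ^ (-β) :=
      hT.eventually_ge_atTop _
    filter_upwards [hlo s η hsp hη, hup (s + t) η (by linarith) hη,
      hup (s - t) η (by linarith) hη, hbig, self_mem_nhdsWithin] with ε g1 g2 g3 g4 hε
    have hε : 0 < ε := hε
    have hℓp : 0 < ε ^ (-γ) := by positivity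
    have hTp : 0 < ε ^ (-β) := by positivity
    have key := lower P V hV hVnonneg (s * ε ^ (-γ)) (t * ε ^ (-γ)) (a * ε) ε (by positivity)
      (mul_le_mul_of_nonneg_right hts.le hℓp.le)
    rw [← add_mul, ← sub_mul] at key
    have hTT := hγβ ε hε
    set T := ε ^ (-β) with hTdef
    rw [show -(s * ε ^ (-γ)) * (a * ε) = -(T * (s * a)) by rw [← hTT]; ring,
      show t * ε ^ (-γ) * (a * ε) = T * (t * a) by rw [← hTT]; ring,
      show -(t * ε ^ (-γ)) * ε = T * (-t) by rw [← hTT]; ring] at key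
    set p := (P {ω | V ω ≤ ε}).toReal
    set E := Real.exp (T * (-K * s ^ α - 2 * η)) with hE
    have k1 : Real.exp (T * (-K * s ^ α - η)) = Real.exp (T * η) * E := by
      rw [hE, ← Real.exp_add]; congr 1; ring
    have k4 : 4 ≤ Real.exp (T * η) := by
      rw [← Real.log_le_iff_le_exp (by norm_num)]
      rwa [div_le_iff₀ hη] at g4
    have k2 : Real.exp (T * (t * a)) * ∫ ω, Real.exp (-((s + t) * ε ^ (-γ)) * V ω) ∂P ≤ E := by
      refine (mul_le_mul_of_nonneg_left g2 (Real.exp_pos _).le).trans ?_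
      rw [← Real.exp_add, hE, Real.exp_le_exp, ← mul_add]
      exact mul_le_mul_of_nonneg_left (by linarith) hTp.le
    have k3 : Real.exp (T * (-t)) * ∫ ω, Real.exp (-((s - t) * ε ^ (-γ)) * V ω) ∂P ≤ E := by
      refine (mul_le_mul_of_nonneg_left g3 (Real.exp_pos _).le).trans ?_
      rw [← Real.exp_add, hE, Real.exp_le_exp, ← mul_add]
      exact mul_le_mul_of_nonneg_left (by linarith) hTp.le
    have hEp : 0 < E := Real.exp_pos _
    have k5 : E < Real.exp (-(T * (s * a))) * p := by
      rw [k1] at g1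
      nlinarith [mul_le_mul_of_nonneg_right k4 hEp.le]
    rw [Real.exp_neg, lt_inv_mul_iff₀ (Real.exp_pos _)] at k5
    refine lt_trans ?_ k5
    rw [hE, ← Real.exp_add, Real.exp_lt_exp, ← mul_add]
    exact mul_lt_mul_of_pos_left (by linarith) hTp
  rw [tendsto_order]
  constructor
  · intro b hb
    filter_upwards [hlower (r₂ - b) (by linarith), self_mem_nhdsWithin] with ε h hε
    have hε : 0 < ε := hε
    have hp := (Real.exp_pos _).trans h
    rw [← Real.lt_log_iff_exp_lt hp, Real.rpow_neg hε.le, inv_mul_lt_iff₀ (by positivity)] at h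
    linarith
  · intro b hb
    filter_upwards [hlower 1 one_pos, hup s₁ ((b - r₂) / 2) hs₁ (by linarith),
      self_mem_nhdsWithin] with ε h g hε
    have hε : 0 < ε := hε
    have hp := (Real.exp_pos _).trans h
    have hub := upper P V hV hVnonneg (s₁ * ε ^ (-γ)) ε (by positivity)
    have hle : (P {ω | V ω ≤ ε}).toReal ≤ Real.exp (ε ^ (-β) * (r₂ + (b - r₂) / 2)) := by
      refine hub.trans ((mul_le_mul_of_nonneg_left g (Real.exp_pos _).le).trans ?_)
      rw [← Real.exp_add, Real.exp_le_exp, mul_assoc, hγβ ε hε, mul_comm s₁, ← mul_add]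
      refine mul_le_mul_of_nonneg_left ?_ (by positivity)
      linarith
    rw [← Real.log_le_iff_le_exp hp, Real.rpow_neg hε.le, le_inv_mul_iff₀ (by positivity)] at hle
    linarith
end
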